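/- Let S = k[x_1,...,x_m,z_0,...,z_n] and let I_X = (x_1,...,x_m) be the ideal of a linear subspace X. Let J ⊆ S be a saturated monomial ideal whose radical is I_X. Then S/J is a Cohen-Macaulay ring if and only if no variable z_j divides any element of the minimal monomial generating set of J, i.e. every minimal monomial generator of J involves only the variables x_1,...,x_m. -/

import Mathlib

open MvPolynomial

/-- The depth of a local ring: the supremum of lengths of regular sequences contained in
the maximal ideal. -/
noncomputable def localRingDepth (R : Type*) [CommRing R] [IsLocalRing R] : ℕ∞ :=
  sSup {c : ℕ∞ | ∃ rs : List R, (rs.length : ℕ∞) = c ∧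
    (∀ r ∈ rs, r ∈ IsLocalRing.maximalIdeal R) ∧ RingTheory.Sequence.IsRegular R rs}

/-- A commutative ring is Cohen-Macaulay if, for every maximal ideal, the localization has
depth equal to its Krull dimension. -/
def IsCohenMacaulayRing (R : Type*) [CommRing R] : Prop :=
  ∀ (P : Ideal R) (hP : P.IsMaximal),
    haveI : P.IsPrime := hP.isPrime
    (localRingDepth (Localization.AtPrime P) : WithBot ℕ∞) =
      ringKrullDim (Localization.AtPrime P)

section CohenMacaulay

open RingTheory.Sequence
open scoped Pointwise

/-- In a Noetherian ring, if `x` lies in the Jacobson radical and is regular on the finite module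
`M`, then every associated prime of `M` together with `x` is contained in an associated prime of
`M / xM`. -/
lemma exists_isAssociatedPrime_quotSMulTop {R : Type*} [CommRing R] [IsNoetherianRing R]
    {M : Type*} [AddCommGroup M] [Module R M] [Module.Finite R M] {x : R}
    (hx : x ∈ Ring.jacobson R) (reg : IsSMulRegular M x) {p : Ideal R}
    (hp : IsAssociatedPrime p M) :
    ∃ q : Ideal R, IsAssociatedPrime q (QuotSMulTop x M) ∧ p ≤ q ∧ x ∈ q := by
  obtain ⟨hpp, y, hy⟩ := isAssociatedPrime_iff.mp hp
  let N : Submodule R M :=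
    { carrier := {u | ∀ r ∈ p, r • u = 0}
      add_mem' := fun {a b} ha hb r hr => by rw [smul_add, ha r hr, hb r hr, add_zero]
      zero_mem' := fun r _ => smul_zero r
      smul_mem' := fun c u hu r hr => by rw [smul_comm, hu r hr, smul_zero] }
  have hyN : y ∈ N := fun r hr => by
    rw [hy, Submodule.mem_colon_singleton] at hr
    simpa using hr
  have hN : ¬ N ≤ x • (⊤ : Submodule R M) := by
    intro hle
    have hNx : N ≤ Ideal.span {x} • N := by
      intro u hu
      obtain ⟨v, -, rfl⟩ := (Submodule.mem_smul_pointwise_iff_exists _ _ _).mp (hle hu)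
      refine Submodule.smul_mem_smul (Ideal.mem_span_singleton_self x) fun r hr => reg ?_
      have := hu r hr
      rw [smul_comm] at this
      simpa using this
    have hbot : N = ⊥ := Submodule.eq_bot_of_le_smul_of_le_jacobson_bot (Ideal.span {x}) N
      (IsNoetherian.noetherian N) hNx
      ((Ideal.span_singleton_le_iff_mem _).mpr (by rwa [Ideal.jacobson_bot]))
    rw [hbot, Submodule.mem_bot] at hyN
    apply hpp.ne_top
    rw [hy, hyN]
    simp
  obtain ⟨u, hu, hux⟩ := Set.not_subset.mp hN
  have hu0 : (Submodule.Quotient.mk u : QuotSMulTop x M) ≠ 0 := by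
    rwa [Ne, Submodule.Quotient.mk_eq_zero]
  obtain ⟨q, hq, hle⟩ := exists_le_isAssociatedPrime_of_isNoetherianRing R _ hu0
  refine ⟨q, hq, fun r hr => hle ?_, hle ?_⟩
  · rw [Submodule.mem_colon_singleton, ← Submodule.Quotient.mk_smul, hu r hr]
    simp
  · rw [Submodule.mem_colon_singleton, ← Submodule.Quotient.mk_smul, Submodule.mem_bot,
      Submodule.Quotient.mk_eq_zero]
    exact Submodule.smul_mem_pointwise_smul _ _ _ trivial

lemma ringKrullDim_quotient_succ_le_of_lt {R : Type*} [CommRing R] {p q : Ideal R} [p.IsPrime]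
    (h : p < q) : ringKrullDim (R ⧸ q) + 1 ≤ ringKrullDim (R ⧸ p) := by
  obtain ⟨a, haq, hap⟩ := Set.exists_of_ssubset h
  refine ringKrullDim_succ_le_of_surjective (Ideal.Quotient.factor h.le)
    (Ideal.Quotient.factor_surjective h.le) (r := Ideal.Quotient.mk p a)
    (mem_nonZeroDivisors_of_ne_zero ?_) ?_
  · rwa [Ne, Ideal.Quotient.eq_zero_iff_mem]
  · rwa [Ideal.Quotient.factor_mk, Ideal.Quotient.eq_zero_iff_mem]

/-- The length of a regular sequence on `M` is at most the dimension of `R / p`, for every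
associated prime `p` of `M`. -/
lemma length_le_ringKrullDim_quotient_of_isAssociatedPrime {R : Type*} [CommRing R]
    [IsNoetherianRing R] [IsLocalRing R] {M : Type*} [AddCommGroup M] [Module R M]
    [Module.Finite R M] {rs : List R} (mem : ∀ r ∈ rs, r ∈ IsLocalRing.maximalIdeal R)
    (reg : IsWeaklyRegular M rs) {p : Ideal R} (hp : IsAssociatedPrime p M) :
    (rs.length : WithBot ℕ∞) ≤ ringKrullDim (R ⧸ p) := by
  induction rs generalizing M p with
  | nil =>
    have := hp.isPrime
    simpa using ringKrullDim_nonneg_of_nontrivial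
  | cons x rs ih =>
    rw [isWeaklyRegular_cons_iff] at reg
    obtain ⟨q, hq, hpq, hxq⟩ := exists_isAssociatedPrime_quotSMulTop
      (by rw [IsLocalRing.ringJacobson_eq_maximalIdeal]; exact mem x (by simp)) reg.1 hp
    have hxp : x ∉ p := by
      obtain ⟨hpp, y, hy⟩ := isAssociatedPrime_iff.mp hp
      intro hx
      rw [hy, Submodule.mem_colon_singleton, Submodule.mem_bot] at hx
      have hy0 : y = 0 := reg.1 (by simpa using hx)
      apply hpp.ne_top
      rw [hy, hy0]
      simp
    have := hp.isPrime
    calc ((x :: rs).length : WithBot ℕ∞) = rs.length + 1 := by simp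
      _ ≤ ringKrullDim (R ⧸ q) + 1 := by
        gcongr
        exact ih (fun r hr => mem r (by simp [hr])) reg.2 hq
      _ ≤ _ := ringKrullDim_quotient_succ_le_of_lt (lt_of_le_of_ne hpq fun h => hxp (h ▸ hxq))

lemma localRingDepth_le_of_forall {R : Type*} [CommRing R] [IsLocalRing R] {d : WithBot ℕ∞}
    (hd : 0 ≤ d)
    (h : ∀ rs : List R, (∀ r ∈ rs, r ∈ IsLocalRing.maximalIdeal R) → IsRegular R rs →
      (rs.length : WithBot ℕ∞) ≤ d) :
    (localRingDepth R : WithBot ℕ∞) ≤ d := by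
  lift d to ℕ∞ using (fun h0 => by simp [h0] at hd)
  rw [WithBot.coe_le_coe, localRingDepth]
  refine sSup_le ?_
  rintro c ⟨rs, rfl, mem, reg⟩
  exact_mod_cast h rs mem reg

lemma localRingDepth_le_ringKrullDim (R : Type*) [CommRing R] [IsNoetherianRing R]
    [IsLocalRing R] : (localRingDepth R : WithBot ℕ∞) ≤ ringKrullDim R := by
  refine localRingDepth_le_of_forall ringKrullDim_nonneg_of_nontrivial fun rs mem reg => ?_
  rw [← ringKrullDim_add_length_eq_ringKrullDim_of_isRegular rs reg]
  have : Nontrivial (R ⧸ Ideal.ofList rs) := by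
    refine Ideal.Quotient.nontrivial_iff.mpr (ne_top_of_le_ne_top
      (IsLocalRing.maximalIdeal.isMaximal R).ne_top (Ideal.span_le.mpr mem))
  exact le_add_of_nonneg_left ringKrullDim_nonneg_of_nontrivial

lemma localRingDepth_le_ringKrullDim_quotient {R : Type*} [CommRing R] [IsNoetherianRing R]
    [IsLocalRing R] {p : Ideal R} (hp : IsAssociatedPrime p R) :
    (localRingDepth R : WithBot ℕ∞) ≤ ringKrullDim (R ⧸ p) := by
  have := hp.isPrime
  exact localRingDepth_le_of_forall ringKrullDim_nonneg_of_nontrivial fun rs mem reg =>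
    length_le_ringKrullDim_quotient_of_isAssociatedPrime mem reg.toIsWeaklyRegular hp

/-- A Noetherian local ring whose depth equals its dimension has no embedded primes. -/
lemma IsAssociatedPrime.mem_minimalPrimes_of_ringKrullDim_le_localRingDepth {R : Type*}
    [CommRing R] [IsNoetherianRing R] [IsLocalRing R]
    (hR : ringKrullDim R ≤ localRingDepth R) {p : Ideal R} (hp : IsAssociatedPrime p R) :
    p ∈ minimalPrimes R := by
  have := hp.isPrime
  obtain ⟨q, hq, hqp⟩ := Ideal.exists_minimalPrimes_le (I := ⊥) (J := p) bot_le
  have := hq.1.1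
  obtain rfl | hlt := eq_or_lt_of_le hqp
  · exact hq
  have h := (ringKrullDim_quotient_succ_le_of_lt hlt).trans
    ((ringKrullDim_quotient_le q).trans (hR.trans (localRingDepth_le_ringKrullDim_quotient hp)))
  have : IsLocalRing (R ⧸ p) := .of_surjective' _ Ideal.Quotient.mk_surjective
  have htop : ringKrullDim (R ⧸ p) ≠ ⊤ := ringKrullDim_ne_top
  have hbot : ringKrullDim (R ⧸ p) ≠ ⊥ := ringKrullDim_ne_bot
  generalize ringKrullDim (R ⧸ p) = d at h htop hbot
  lift d to ℕ∞ using hbot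
  lift d to ℕ using (fun h0 => htop (by rw [h0]; rfl))
  exact absurd h (by norm_cast; omega)

/-- If every maximal ideal contains a weakly regular sequence of length at least the dimension,
then the ring is Cohen-Macaulay. -/
lemma IsCohenMacaulayRing.of_isWeaklyRegular {R : Type*} [CommRing R] [IsNoetherianRing R]
    (h : ∀ P : Ideal R, P.IsMaximal → ∃ rs : List R, (∀ r ∈ rs, r ∈ P) ∧ IsWeaklyRegular R rs ∧
      ringKrullDim R ≤ rs.length) : IsCohenMacaulayRing R := by
  intro P hP
  have : P.IsPrime := hP.isPrime
  obtain ⟨rs, mem, reg, hdim⟩ := h P hP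
  have : IsNoetherianRing (Localization.AtPrime P) :=
    IsLocalization.isNoetherianRing P.primeCompl _ inferInstance
  refine le_antisymm (localRingDepth_le_ringKrullDim _) ?_
  calc ringKrullDim (Localization.AtPrime P) = P.height :=
        IsLocalization.AtPrime.ringKrullDim_eq_height P _
    _ ≤ ringKrullDim R := Ideal.height_le_ringKrullDim_of_ne_top hP.ne_top
    _ ≤ rs.length := hdim
    _ ≤ localRingDepth (Localization.AtPrime P) := by
      rw [← WithBot.coe_natCast, WithBot.coe_le_coe]
      refine le_sSup ⟨rs.map (algebraMap R _), by simp, fun r hr => ?_,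
        reg.isRegular_of_isLocalization_of_mem _ P mem⟩
      obtain ⟨a, ha, rfl⟩ := List.mem_map.mp hr
      exact (IsLocalization.AtPrime.to_map_mem_maximal_iff _ P a).mpr (mem a ha)

lemma RingEquiv.isWeaklyRegular_map_iff {R S : Type*} [CommRing R] [CommRing S] (e : R ≃+* S)
    (rs : List R) : IsWeaklyRegular S (rs.map e) ↔ IsWeaklyRegular R rs :=
  (e.toAddEquiv.isWeaklyRegular_congr <| List.forall₂_map_right_iff.mpr <|
    List.forall₂_same.mpr fun r _ x => map_mul e r x).symm

lemma Polynomial.Monic.free_quotSMulTop {D : Type*} [CommRing D]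
    {g : Polynomial D} (hg : g.Monic) : Module.Free D (QuotSMulTop g (Polynomial D)) := by
  have h : Ideal.span {g} = g • (⊤ : Ideal (Polynomial D)) := by
    simp [← Submodule.ideal_span_singleton_smul]
  have : Module.Free D (Polynomial D ⧸ Ideal.span {g}) := hg.free_adjoinRoot
  exact Module.Free.of_equiv ((Submodule.quotEquivOfEq _ _ h).restrictScalars D)

/-- Monic polynomials in pairwise distinct variables form a weakly regular sequence. -/
lemma MvPolynomial.isWeaklyRegular_ofFn_aeval_X {B : Type*} [CommRing B] {N : ℕ}
    (f : Fin N → Polynomial B) (hf : ∀ i, (f i).Monic) :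
    IsWeaklyRegular (MvPolynomial (Fin N) B)
      (List.ofFn fun i => Polynomial.aeval (X i : MvPolynomial (Fin N) B) (f i)) := by
  induction N with
  | zero => simp
  | succ N ih =>
    let D := MvPolynomial (Fin N) B
    let g : Polynomial D := (f 0).map (algebraMap B D)
    have hg : g.Monic := (hf 0).map _
    have key : IsWeaklyRegular (Polynomial D)
        (g :: (List.ofFn fun i => Polynomial.aeval (X i : D) (f i.succ)).map
          (algebraMap D (Polynomial D))) := by
      rw [isWeaklyRegular_cons_iff]
      refine ⟨hg.isRegular.left, ?_⟩
      rw [isWeaklyRegular_map_algebraMap_iff]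
      have := hg.free_quotSMulTop
      exact ((TensorProduct.rid D _).isWeaklyRegular_congr _).mp
        ((ih (fun i => f i.succ) fun i => hf _).isWeaklyRegular_lTensor
          (M₂ := QuotSMulTop g (Polynomial D)))
    rw [← (finSuccEquiv B N).toRingEquiv.isWeaklyRegular_map_iff]
    convert key using 1
    simp only [List.ofFn_succ, List.map_cons, List.map_ofFn, Function.comp_def,
      List.cons.injEq]
    have h (p : MvPolynomial (Fin (N + 1)) B) (q : Polynomial B) :
        (finSuccEquiv B N).toRingEquiv (Polynomial.aeval p q) =
          Polynomial.aeval (finSuccEquiv B N p) q :=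
      (Polynomial.aeval_algHom_apply (finSuccEquiv B N) p q).symm
    constructor
    · rw [h, finSuccEquiv_X_zero]
      simp [g, D, Polynomial.aeval_def, Polynomial.map]
      rfl
    · congr 1
      funext i
      rw [h, finSuccEquiv_X_succ]
      exact Polynomial.aeval_algebraMap_apply (Polynomial D) (X i : D) (f i.succ)

/-- A polynomial ring over an Artinian ring is Cohen-Macaulay, as is every ring isomorphic to
it. -/
lemma IsCohenMacaulayRing.of_ringEquiv_mvPolynomial {A B : Type*} [CommRing A] [CommRing B]
    [IsArtinianRing B] {N : ℕ} (e : MvPolynomial (Fin N) B ≃+* A) : IsCohenMacaulayRing A := by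
  have : IsNoetherianRing A := isNoetherianRing_of_ringEquiv _ e
  refine .of_isWeaklyRegular fun P hP => ?_
  let Q : Ideal (MvPolynomial (Fin N) B) := P.comap e
  have hQ : Q.IsMaximal := Ideal.comap_isMaximal_of_equiv e
  have hint := quotient_mk_comp_C_isIntegral_of_isJacobsonRing Q
  choose f hf hf0 using fun i : Fin N => hint (Ideal.Quotient.mk Q (X i))
  have hmem (i : Fin N) : Polynomial.aeval (X i : MvPolynomial (Fin N) B) (f i) ∈ Q := by
    rw [← Ideal.Quotient.eq_zero_iff_mem, ← hf0 i, Polynomial.aeval_def, Polynomial.hom_eval₂]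
    rfl
  refine ⟨(List.ofFn fun i => Polynomial.aeval (X i : MvPolynomial (Fin N) B) (f i)).map e,
    ?_, (e.isWeaklyRegular_map_iff _).mpr (isWeaklyRegular_ofFn_aeval_X f hf), ?_⟩
  · simp only [List.mem_map, List.mem_ofFn]
    rintro _ ⟨_, ⟨i, rfl⟩, rfl⟩
    exact hmem i
  · have hB : ringKrullDim B ≤ 0 := Order.KrullDimLE.krullDim_le (n := 0) (α := PrimeSpectrum B)
    rw [← ringKrullDim_eq_of_ringEquiv e, MvPolynomial.ringKrullDim_of_isNoetherianRing]
    simpa using add_le_add_left hB (N : WithBot ℕ∞)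

/-- In a Noetherian Cohen-Macaulay ring, every zero divisor lies in a minimal prime. -/
lemma IsCohenMacaulayRing.exists_mem_minimalPrimes {A : Type*} [CommRing A] [IsNoetherianRing A]
    (hA : IsCohenMacaulayRing A) {a b : A} (hb : b ≠ 0) (hab : a * b = 0) :
    ∃ q ∈ minimalPrimes A, a ∈ q := by
  obtain ⟨P, hP, hle⟩ := Ideal.exists_le_maximal ((⊥ : Ideal A).colon {b}) fun h => hb <| by
    have : (1 : A) ∈ (⊥ : Ideal A).colon {b} := h ▸ Submodule.mem_top
    rw [Submodule.mem_colon_singleton] at this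
    simpa using this
  have : P.IsPrime := hP.isPrime
  have : IsNoetherianRing (Localization.AtPrime P) :=
    IsLocalization.isNoetherianRing P.primeCompl _ inferInstance
  have hb' : algebraMap A (Localization.AtPrime P) b ≠ 0 := by
    rw [Ne, IsLocalization.map_eq_zero_iff P.primeCompl]
    rintro ⟨c, hc⟩
    refine c.2 (hle ?_)
    rw [Submodule.mem_colon_singleton]
    simpa using hc
  obtain ⟨p, hp, hpb⟩ :=
    exists_le_isAssociatedPrime_of_isNoetherianRing (Localization.AtPrime P) _ hb'
  have hmin := hp.mem_minimalPrimes_of_ringKrullDim_le_localRingDepth (hA P hP).ge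
  refine ⟨p.comap (algebraMap A _), ?_, hpb ?_⟩
  · have := IsLocalization.minimalPrimes_map P.primeCompl (Localization.AtPrime P) (⊥ : Ideal A)
    rw [Ideal.map_bot] at this
    exact this.le hmin
  · rw [Submodule.mem_colon_singleton, smul_eq_mul, ← map_mul, hab, map_zero]
    simp

end CohenMacaulay

section MonomialIdeal

variable {k σ : Type*} [Field k] {J : Ideal (MvPolynomial σ k)}

lemma monomial_one_mem_of_le {p q : σ →₀ ℕ} (hp : monomial p (1 : k) ∈ J) (hpq : p ≤ q) :
    monomial q (1 : k) ∈ J := by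
  have : monomial q (1 : k) = monomial (q - p) 1 * monomial p 1 := by
    rw [monomial_mul, one_mul, tsub_add_cancel_of_le hpq]
  exact this ▸ J.mul_mem_left _ hp

lemma monomial_one_mem_of_mem_support {G : Set (σ →₀ ℕ)}
    (hJ : J = Ideal.span ((fun p => monomial p (1 : k)) '' G)) {f : MvPolynomial σ k} (hf : f ∈ J)
    {p : σ →₀ ℕ} (hp : p ∈ f.support) : monomial p (1 : k) ∈ J := by
  rw [hJ, mem_ideal_span_monomial_image] at hf
  obtain ⟨q, hq, hqp⟩ := hf p hp
  exact monomial_one_mem_of_le (hJ ▸ Ideal.subset_span ⟨q, hq, rfl⟩) hqp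

lemma exists_monomial_sub_single_mem {G : Set (σ →₀ ℕ)}
    (hJ : J = Ideal.span ((fun p => monomial p (1 : k)) '' G)) {p : σ →₀ ℕ}
    (hp : monomial p (1 : k) ∈ J * Ideal.span (Set.range X)) :
    ∃ i, p i ≠ 0 ∧ monomial (p - Finsupp.single i 1) (1 : k) ∈ J := by
  classical
  suffices ∀ f ∈ J * Ideal.span (Set.range X), ∀ q ∈ f.support,
      ∃ i, q i ≠ 0 ∧ monomial (q - Finsupp.single i 1) (1 : k) ∈ J from
    this _ hp p (by simp [mem_support_iff])
  intro f hf
  induction hf using Submodule.mul_induction_on' with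
  | mem_mul_mem g hg h hh =>
    intro q hq
    obtain ⟨a, ha, b, hb, rfl⟩ := Finset.mem_add.mp (support_mul g h hq)
    rw [← Set.image_univ, mem_ideal_span_X_image] at hh
    obtain ⟨i, -, hi⟩ := hh b hb
    refine ⟨i, by simp [hi], monomial_one_mem_of_le (monomial_one_mem_of_mem_support hJ hg ha) ?_⟩
    rw [add_tsub_assoc_of_le (by simpa [Nat.one_le_iff_ne_zero] using hi)]
    exact le_self_add
  | add g _ h _ ihg ihh =>
    intro q hq
    rcases Finset.mem_union.mp (support_add hq) with hq | hq
    exacts [ihg q hq, ihh q hq]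

/-- Every monomial of a monomial ideal is divisible by a minimal generator. -/
lemma exists_le_monomial_notMem_mul_span_X {G : Set (σ →₀ ℕ)}
    (hJ : J = Ideal.span ((fun p => monomial p (1 : k)) '' G)) {p : σ →₀ ℕ}
    (hp : monomial p (1 : k) ∈ J) :
    ∃ q ≤ p, monomial q (1 : k) ∈ J ∧ monomial q (1 : k) ∉ J * Ideal.span (Set.range X) := by
  induction hd : p.degree using Nat.strong_induction_on generalizing p with
  | _ d ih =>
    by_cases hmem : monomial p (1 : k) ∈ J * Ideal.span (Set.range X)
    · obtain ⟨i, hi, hsub⟩ := exists_monomial_sub_single_mem hJ hmem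
      have hle : Finsupp.single i 1 ≤ p := by simpa [Nat.one_le_iff_ne_zero] using hi
      have hdeg : (p - Finsupp.single i 1).degree + 1 = p.degree := by
        conv_rhs => rw [← tsub_add_cancel_of_le hle, map_add, Finsupp.degree_single]
      obtain ⟨q, hq, h⟩ := ih _ (by omega) hsub rfl
      exact ⟨q, hq.trans tsub_le_self, h⟩
    · exact ⟨p, le_rfl, hp, hmem⟩

end MonomialIdeal

lemma exists_finsupp_mapDomain_inl_eq {α β : Type*} {q : α ⊕ β →₀ ℕ}
    (hq : ∀ j, q (Sum.inr j) = 0) : ∃ q' : α →₀ ℕ, q'.mapDomain Sum.inl = q := by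
  refine ⟨q.comapDomain Sum.inl Sum.inl_injective.injOn,
    Finsupp.mapDomain_comapDomain _ Sum.inl_injective _ ?_⟩
  rintro (a | b) h
  · exact ⟨a, rfl⟩
  · exact absurd (hq b) (by simpa using h)

lemma MvPolynomial.isArtinianRing_quotient_of_X_mem_radical {k σ : Type*} [Field k] [Finite σ]
    {I : Ideal (MvPolynomial σ k)} (hI : ∀ i, X i ∈ I.radical) :
    IsArtinianRing (MvPolynomial σ k ⧸ I) := by
  have hint : Algebra.IsIntegral k (MvPolynomial σ k ⧸ I) := by
    have htop : Algebra.adjoin k (Set.range fun i => Ideal.Quotient.mkₐ k I (X i)) = ⊤ := by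
      rw [show (fun i => Ideal.Quotient.mkₐ k I (X i)) = Ideal.Quotient.mkₐ k I ∘ X from rfl,
        Set.range_comp, ← AlgHom.map_adjoin, adjoin_range_X, Algebra.map_top,
        AlgHom.range_eq_top]
      exact Ideal.Quotient.mkₐ_surjective k I
    rw [← integralClosure_eq_top_iff, ← top_le_iff, ← htop, Algebra.adjoin_le_iff]
    rintro _ ⟨i, rfl⟩
    obtain ⟨a, ha⟩ := hI i
    refine ⟨Polynomial.X ^ a, Polynomial.monic_X_pow a, ?_⟩
    rw [Polynomial.eval₂_X_pow, ← map_pow]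
    exact Ideal.Quotient.eq_zero_iff_mem.mpr ha
  have : Module.Finite k (MvPolynomial σ k ⧸ I) := Algebra.IsIntegral.finite
  exact IsArtinianRing.of_finite k _

/-- An ideal extended from `k[x_1,…,x_m]` has quotient a polynomial ring over the quotient of
`k[x_1,…,x_m]`. -/
lemma MvPolynomial.nonempty_ringEquiv_quotient_map_rename_inl {k α β : Type*} [Field k]
    (I : Ideal (MvPolynomial α k)) :
    Nonempty (MvPolynomial β (MvPolynomial α k ⧸ I) ≃+*
      MvPolynomial (α ⊕ β) k ⧸ I.map (rename Sum.inl : _ →ₐ[k] MvPolynomial (α ⊕ β) k)) := by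
  let E : MvPolynomial (α ⊕ β) k ≃ₐ[k] MvPolynomial β (MvPolynomial α k) :=
    (renameEquiv k (Equiv.sumComm α β)).trans (sumAlgEquiv k β α)
  have hE : E.toRingEquiv.toRingHom.comp
      (rename Sum.inl : MvPolynomial α k →ₐ[k] MvPolynomial (α ⊕ β) k).toRingHom = C := by
    ext i
    · simp [E]
    · simp [E]
  refine ⟨(quotientEquivQuotientMvPolynomial (σ := β) I).toRingEquiv.trans
    (Ideal.quotientEquiv _ _ E.toRingEquiv ?_).symm⟩
  rw [← hE, ← Ideal.map_map]
  rfl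

/-- let `S = k[x_1,…,x_m,z_0,…,z_n]`, `I_X = (x_1,…,x_m)` and `J ⊆ S` a
saturated monomial ideal with radical `I_X`.  Then `S/J` is Cohen-Macaulay iff every
minimal monomial generator of `J` (a monomial in `J` but not in `J·(all variables)`)
involves only the variables `x_1,…,x_m`, i.e. no variable `z_j` divides any minimal
monomial generator. -/
theorem quotient_cohenMacaulay_iff_generators_in_x_variables
    (k : Type*) [Field k] (m n : ℕ)
    (J : Ideal (MvPolynomial (Fin m ⊕ Fin (n + 1)) k))
    (hmono : ∃ G : Set ((Fin m ⊕ Fin (n + 1)) →₀ ℕ),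
      J = Ideal.span ((fun p => monomial p (1 : k)) '' G))
    (hrad : J.radical = Ideal.span
      (Set.range fun i : Fin m =>
        (X (Sum.inl i) : MvPolynomial (Fin m ⊕ Fin (n + 1)) k)))
    (hsat : Submodule.colon (J : Submodule (MvPolynomial (Fin m ⊕ Fin (n + 1)) k)
        (MvPolynomial (Fin m ⊕ Fin (n + 1)) k))
      (Ideal.span (Set.range (X : (Fin m ⊕ Fin (n + 1)) →
        MvPolynomial (Fin m ⊕ Fin (n + 1)) k)) :
        Submodule (MvPolynomial (Fin m ⊕ Fin (n + 1)) k)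
          (MvPolynomial (Fin m ⊕ Fin (n + 1)) k)) = J) :
    IsCohenMacaulayRing (MvPolynomial (Fin m ⊕ Fin (n + 1)) k ⧸ J) ↔
      ∀ p : (Fin m ⊕ Fin (n + 1)) →₀ ℕ,
        monomial p (1 : k) ∈ J →
        monomial p (1 : k) ∉ J * Ideal.span (Set.range X) →
        ∀ j : Fin (n + 1), p (Sum.inr j) = 0 := by
  obtain ⟨G, hG⟩ := hmono
  constructor
  · intro hCM p hp hmin j
    by_contra hj
    have hle : Finsupp.single (Sum.inr j) 1 ≤ p := by simpa [Nat.one_le_iff_ne_zero] using hj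
    have hXp : X (Sum.inr j) * monomial (p - Finsupp.single (Sum.inr j) 1) (1 : k) =
        monomial p 1 := by
      rw [X, monomial_mul, one_mul, add_tsub_cancel_of_le hle]
    have hq : monomial (p - Finsupp.single (Sum.inr j) 1) (1 : k) ∉ J := fun h => hmin <| by
      rw [← hXp, mul_comm (X _)]
      exact Ideal.mul_mem_mul h (Ideal.subset_span ⟨_, rfl⟩)
    obtain ⟨q, hqmin, hXq⟩ := hCM.exists_mem_minimalPrimes
      (a := Ideal.Quotient.mk J (X (Sum.inr j)))
      (b := Ideal.Quotient.mk J (monomial (p - Finsupp.single (Sum.inr j) 1) (1 : k)))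
      (by rwa [Ne, Ideal.Quotient.eq_zero_iff_mem])
      (by rwa [← map_mul, hXp, Ideal.Quotient.eq_zero_iff_mem])
    have hmem : X (Sum.inr j) ∈ ⋃ p ∈ J.minimalPrimes,
        (p : Set (MvPolynomial (Fin m ⊕ Fin (n + 1)) k)) := by
      rw [Ideal.minimalPrimes_eq_comap]
      exact Set.mem_biUnion ⟨q, hqmin, rfl⟩ hXq
    rw [Ideal.iUnion_minimalPrimes, Set.mem_ofPred_eq, hrad,
      Set.range_comp' X Sum.inl] at hmem
    obtain ⟨y, hy, hXy⟩ := hmem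
    rw [mem_ideal_span_X_image] at hy hXy
    refine hy fun a ha => ?_
    obtain ⟨_, ⟨i, rfl⟩, hi⟩ := hXy (Finsupp.single (Sum.inr j) 1 + a) (by
      rw [mem_support_iff, coeff_X_mul]
      exact mem_support_iff.mp ha)
    exact ⟨Sum.inl i, ⟨i, rfl⟩, by simpa using hi⟩
  · intro hgen
    let r : MvPolynomial (Fin m) k →ₐ[k] MvPolynomial (Fin m ⊕ Fin (n + 1)) k := rename Sum.inl
    let I : Ideal (MvPolynomial (Fin m) k) := J.comap r
    have hJ : I.map r = J := by
      refine le_antisymm Ideal.map_comap_le ?_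
      conv_lhs => rw [hG]
      rw [Ideal.span_le]
      rintro _ ⟨g, hg, rfl⟩
      obtain ⟨q, hqg, hqJ, hq⟩ := exists_le_monomial_notMem_mul_span_X hG
        (hG ▸ Ideal.subset_span ⟨g, hg, rfl⟩ : monomial g (1 : k) ∈ J)
      obtain ⟨q', rfl⟩ := exists_finsupp_mapDomain_inl_eq (hgen q hqJ hq)
      refine monomial_one_mem_of_le ?_ hqg
      rw [← rename_monomial] at hqJ ⊢
      exact Ideal.mem_map_of_mem r hqJ
    have hI (i : Fin m) : X i ∈ I.radical := by
      obtain ⟨a, ha⟩ : X (Sum.inl i) ∈ J.radical := hrad ▸ Ideal.subset_span ⟨i, rfl⟩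
      refine ⟨a, ?_⟩
      rw [Ideal.mem_comap, map_pow, rename_X]
      exact ha
    have := isArtinianRing_quotient_of_X_mem_radical hI
    obtain ⟨e⟩ := nonempty_ringEquiv_quotient_map_rename_inl (β := Fin (n + 1)) I
    exact .of_ringEquiv_mvPolynomial (e.trans (Ideal.quotEquivOfEq hJ))
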